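/- dim_ℂ (Syz̄_4 / Kos̄_4) = (m²(m²−1)/12)·binom(n+3,4) + binom(m+3,4)·(n²(n²−1)/12) + (m(m+1)(m+2)(m−1)/8)·(n(n+1)(n+2)(n−1)/8) + (m(m+1)(m+2)(m−1)/8)·(n(n+1)(n−1)(n−2)/8) + (m(m+1)(m−1)(m−2)/8)·(n(n+1)(n+2)(n−1)/8). (This is the degree-4 part of the first Koszul homology of the generalized 2×2 permanents.) -/

import Mathlib

open MvPolynomial

/-- Index set for the generalized 2×2 permanents of a generic `m × n` matrix:
quadruples `((i,i'),(j,j'))` with `i ≤ i'` and `j ≤ j'`. -/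
def PermIdx (m n : ℕ) : Type :=
  {w : (Fin m × Fin m) × (Fin n × Fin n) // w.1.1 ≤ w.1.2 ∧ w.2.1 ≤ w.2.2}

instance (m n : ℕ) : Fintype (PermIdx m n) := by unfold PermIdx; infer_instance

instance (m n : ℕ) : DecidableEq (PermIdx m n) := by unfold PermIdx; infer_instance

/-- The generalized 2×2 permanent
`p_{(i,i'),(j,j')} = x_{i,j} x_{i',j'} + x_{i,j'} x_{i',j}`. -/
noncomputable def perm {m n : ℕ} (w : PermIdx m n) : MvPolynomial (Fin m × Fin n) ℂ :=
  X (w.1.1.1, w.1.2.1) * X (w.1.1.2, w.1.2.2) + X (w.1.1.1, w.1.2.2) * X (w.1.1.2, w.1.2.1)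

/-- `Syz̄_d`: the ℂ-vector space of degree-`d` syzygies of the generalized 2×2
permanents, i.e. families `c = (c_w)` of homogeneous polynomials of degree
`d - 2` with `∑_w c_w p_w = 0`. -/
noncomputable def SyzBar (m n d : ℕ) :
    Submodule ℂ (PermIdx m n → MvPolynomial (Fin m × Fin n) ℂ) where
  carrier := {c | (∀ w, c w ∈ homogeneousSubmodule (Fin m × Fin n) ℂ (d - 2)) ∧
    ∑ w, c w * perm w = 0}
  zero_mem' := by
    refine ⟨fun w => Submodule.zero_mem _, ?_⟩
    simp
  add_mem' := by
    rintro a b ⟨ha1, ha2⟩ ⟨hb1, hb2⟩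
    refine ⟨fun w => Submodule.add_mem _ (ha1 w) (hb1 w), ?_⟩
    simp only [Pi.add_apply, add_mul]
    rw [Finset.sum_add_distrib, ha2, hb2, add_zero]
  smul_mem' := by
    rintro r a ⟨ha1, ha2⟩
    refine ⟨fun w => Submodule.smul_mem _ r (ha1 w), ?_⟩
    simp only [Pi.smul_apply, smul_mul_assoc]
    rw [← Finset.smul_sum, ha2, smul_zero]

/-- The `S`-submodule of the free module `F = ⊕_w S·e_w` generated by the
Koszul syzygies `p_{w'}·e_w − p_w·e_{w'}`. -/
noncomputable def KosModBar (m n : ℕ) :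
    Submodule (MvPolynomial (Fin m × Fin n) ℂ)
      (PermIdx m n → MvPolynomial (Fin m × Fin n) ℂ) :=
  Submodule.span _ {k | ∃ w w' : PermIdx m n,
    k = Pi.single w (perm w') - Pi.single w' (perm w)}

/-- `Kos̄_d`: the space of degree-`d` syzygies lying in the `S`-submodule
generated by the Koszul syzygies. -/
noncomputable def KosBar (m n d : ℕ) :
    Submodule ℂ (PermIdx m n → MvPolynomial (Fin m × Fin n) ℂ) :=
  SyzBar m n d ⊓ Submodule.restrictScalars ℂ (KosModBar m n)


section General
variable {σ : Type} [Fintype σ] [DecidableEq σ]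

lemma aux_finrank_homog (d : ℕ) :
    Module.finrank ℂ (homogeneousSubmodule σ ℂ d) = Nat.multichoose (Fintype.card σ) d := by
  rw [homogeneousSubmodule_eq_finsupp_supported]
  rw [LinearEquiv.finrank_eq (AddMonoidAlgebra.supportedEquivFinsupp (R := ℂ) (S := ℂ)
    {s : σ →₀ ℕ | s.degree = d})]
  have e : Sym σ d ≃ {s : σ →₀ ℕ | s.degree = d} :=
    (Sym.equivNatSum σ d).trans (Equiv.subtypeEquivRight (fun _ => Iff.rfl))
  let _ : Fintype {s : σ →₀ ℕ | s.degree = d} := Fintype.ofEquiv _ e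
  rw [Module.finrank_finsupp_self, ← Fintype.card_congr e, Sym.card_sym_eq_multichoose]

lemma aux_exists_tuple (d : ℕ) (s : σ →₀ ℕ) (hs : s.degree = d) :
    ∃ t : Fin d → σ, s = ∑ k, Finsupp.single (t k) 1 := by
  obtain ⟨l, hl⟩ := Quot.exists_rep (Finsupp.toMultiset s)
  have hl' : (l : Multiset σ) = Finsupp.toMultiset s := hl
  have hlen : l.length = d := by
    have h1 := congrArg Multiset.card hl'
    rw [Multiset.coe_card, Finsupp.card_toMultiset] at h1
    rw [h1, ← hs]
    rfl
  subst hlen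
  refine ⟨l.get, ?_⟩
  apply Finsupp.orderIsoMultiset.injective
  rw [Finsupp.coe_orderIsoMultiset]
  rw [map_sum, ← hl']
  simp only [Finsupp.toMultiset_single, one_smul]
  have h2 := Fin.sum_univ_fun_getElem l (fun a => ({a} : Multiset σ))
  have h3 := Multiset.sum_map_singleton (l : Multiset σ)
  rw [Multiset.map_coe, Multiset.sum_coe] at h3
  exact h3.symm.trans h2.symm

lemma aux_prod_X (d : ℕ) (t : Fin d → σ) :
    (∏ k, X (t k) : MvPolynomial σ ℂ) = monomial (∑ k, Finsupp.single (t k) 1) 1 := by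
  simp [monomial_sum_one, X]

lemma aux_homog_span (d : ℕ) :
    homogeneousSubmodule σ ℂ d =
      Submodule.span ℂ (Set.range fun t : Fin d → σ => (∏ k, X (t k) : MvPolynomial σ ℂ)) := by
  apply le_antisymm
  · intro f hf
    rw [f.as_sum]
    refine Submodule.sum_mem _ fun s hs => ?_
    have hd : s.degree = d := by
      by_contra h
      exact (mem_support_iff.mp hs) (IsHomogeneous.coeff_eq_zero hf h)
    obtain ⟨t, ht⟩ := aux_exists_tuple d s hd
    have : monomial s (coeff s f) = coeff s f • (∏ k, X (t k) : MvPolynomial σ ℂ) := by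
      rw [aux_prod_X, ← ht, smul_monomial, smul_eq_mul, mul_one]
    rw [this]
    exact Submodule.smul_mem _ _ (Submodule.subset_span ⟨t, rfl⟩)
  · rw [Submodule.span_le]
    rintro _ ⟨t, rfl⟩
    have := IsHomogeneous.prod (Finset.univ) (fun k => (X (t k) : MvPolynomial σ ℂ)) (fun _ => 1)
      (fun k _ => isHomogeneous_X ℂ (t k))
    simpa using this

lemma aux_exists_perm {d : ℕ} (t t' : Fin d → σ)
    (h : ∑ k, Finsupp.single (t k) 1 = ∑ k, (Finsupp.single (t' k) 1 : σ →₀ ℕ)) :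
    ∃ e : Equiv.Perm (Fin d), ∀ k, t' (e k) = t k := by
  have hc : ∀ a, Fintype.card {k // t k = a} = Fintype.card {k // t' k = a} := by
    intro a
    have := DFunLike.congr_fun h a
    simp only [Finsupp.coe_finsetSum, Finset.sum_apply, Finsupp.single_apply] at this
    simpa [Fintype.card_subtype] using this
  exact ⟨Equiv.ofFiberEquiv (fun a => Fintype.equivOfCardEq (hc a)),
    fun k => Equiv.ofFiberEquiv_map _ k⟩
end General

/-! ### The degree four part of the ideal -/

section Ideal
variable {m n : ℕ}

/-- The monomial `∏ x_{r k, c k}`. -/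
noncomputable def auxMono (r : Fin 4 → Fin m) (c : Fin 4 → Fin n) :
    MvPolynomial (Fin m × Fin n) ℂ := ∏ k, X (r k, c k)

/-- The linear map `c ↦ ∑ c_w p_w`. -/
noncomputable def auxMap (m n : ℕ) :
    (PermIdx m n → MvPolynomial (Fin m × Fin n) ℂ) →ₗ[ℂ] MvPolynomial (Fin m × Fin n) ℂ where
  toFun c := ∑ w, c w * perm w
  map_add' a b := by simp [add_mul, Finset.sum_add_distrib]
  map_smul' r a := by simp [Finset.smul_sum]

/-- Families of quadrics. -/
noncomputable def auxQuad (m n : ℕ) :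
    Submodule ℂ (PermIdx m n → MvPolynomial (Fin m × Fin n) ℂ) :=
  Submodule.pi Set.univ (fun _ => homogeneousSubmodule (Fin m × Fin n) ℂ 2)

/-- The degree four part of the ideal. -/
noncomputable def auxI4 (m n : ℕ) : Submodule ℂ (MvPolynomial (Fin m × Fin n) ℂ) :=
  (auxQuad m n).map (auxMap m n)

lemma auxI4_mem_perm (w : PermIdx m n) (f : MvPolynomial (Fin m × Fin n) ℂ)
    (hf : f ∈ homogeneousSubmodule (Fin m × Fin n) ℂ 2) : perm w * f ∈ auxI4 m n := by
  refine ⟨Pi.single w f, ?_, ?_⟩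
  · intro v _
    by_cases h : v = w
    · subst h; simpa using hf
    · simp [h]
  · change ∑ v, (Pi.single w f : PermIdx m n → MvPolynomial (Fin m × Fin n) ℂ) v * perm v = _
    rw [Finset.sum_eq_single w]
    · simp [mul_comm]
    · intro v _ h; simp [h]
    · simp

lemma auxI4_mem_gen (i i' : Fin m) (j j' : Fin n) (f : MvPolynomial (Fin m × Fin n) ℂ)
    (hf : f ∈ homogeneousSubmodule (Fin m × Fin n) ℂ 2) :
    (X (i, j) * X (i', j') + X (i, j') * X (i', j)) * f ∈ auxI4 m n := by
  rcases le_total i i' with h | h <;> rcases le_total j j' with h' | h'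
  · exact auxI4_mem_perm ⟨((i, i'), (j, j')), h, h'⟩ f hf
  · convert auxI4_mem_perm ⟨((i, i'), (j', j)), h, h'⟩ f hf using 1
    simp only [perm]; ring
  · convert auxI4_mem_perm ⟨((i', i), (j, j')), h, h'⟩ f hf using 1
    simp only [perm]; ring
  · convert auxI4_mem_perm ⟨((i', i), (j', j)), h, h'⟩ f hf using 1
    simp only [perm]; ring

lemma auxI4_swap (r : Fin 4 → Fin m) (c : Fin 4 → Fin n) (a b : Fin 4) (hab : a ≠ b) :
    auxMono r c + auxMono r (c ∘ Equiv.swap a b) ∈ auxI4 m n := by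
  have hsplit : ∀ F : Fin 4 → MvPolynomial (Fin m × Fin n) ℂ,
      ∏ k, F k = F a * F b * ∏ k ∈ (Finset.univ.erase a).erase b, F k := by
    intro F
    rw [← Finset.mul_prod_erase Finset.univ F (Finset.mem_univ a),
      ← Finset.mul_prod_erase (Finset.univ.erase a) F (a := b) (by simp [hab.symm]), mul_assoc]
  have hrest : ∏ k ∈ (Finset.univ.erase a).erase b,
      (X (r k, (c ∘ Equiv.swap a b) k) : MvPolynomial (Fin m × Fin n) ℂ) =
      ∏ k ∈ (Finset.univ.erase a).erase b, X (r k, c k) := by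
    refine Finset.prod_congr rfl fun k hk => ?_
    simp only [Finset.mem_erase, Finset.mem_univ, and_true] at hk
    rw [Function.comp, Equiv.swap_apply_of_ne_of_ne hk.2 hk.1]
  have hom : ∏ k ∈ (Finset.univ.erase a).erase b, X (r k, c k) ∈
      homogeneousSubmodule (Fin m × Fin n) ℂ 2 := by
    have := IsHomogeneous.prod ((Finset.univ.erase a).erase b)
      (fun k => (X (r k, c k) : MvPolynomial (Fin m × Fin n) ℂ)) (fun _ => 1)
      (fun k _ => isHomogeneous_X ℂ _)
    have hcard : ((Finset.univ.erase a).erase b).card = 2 := by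
      rw [Finset.card_erase_of_mem (by simp [hab.symm]), Finset.card_erase_of_mem (by simp)]
      simp
    rw [Finset.sum_const, hcard] at this
    simpa using this
  convert auxI4_mem_gen (r a) (r b) (c a) (c b) _ hom using 1
  unfold auxMono
  rw [hsplit, hsplit (fun k => X (r k, (c ∘ Equiv.swap a b) k)), hrest]
  simp only [Function.comp, Equiv.swap_apply_left, Equiv.swap_apply_right]
  ring

lemma auxMono_perm (r : Fin 4 → Fin m) (c : Fin 4 → Fin n) (e : Equiv.Perm (Fin 4)) :
    auxMono (r ∘ e) (c ∘ e) = auxMono r c :=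
  Equiv.prod_comp e (fun k => (X (r k, c k) : MvPolynomial (Fin m × Fin n) ℂ))

lemma auxI4_sign (r : Fin 4 → Fin m) (e : Equiv.Perm (Fin 4)) : ∀ (c : Fin 4 → Fin n),
    auxMono r (c ∘ e) - ((Equiv.Perm.sign e : ℤ) : ℂ) • auxMono r c ∈ auxI4 m n := by
  induction e using Equiv.Perm.swap_induction_on with
  | one => intro c; simp
  | swap_mul f x y hxy ih =>
    intro c
    have h1 := ih (c ∘ Equiv.swap x y)
    have h2 := auxI4_swap r c x y hxy
    have h3 := Submodule.add_mem _ h1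
      (Submodule.smul_mem _ (((Equiv.Perm.sign f : ℤ) : ℂ)) h2)
    convert h3 using 1
    rw [Equiv.Perm.sign_mul, Equiv.Perm.sign_swap hxy, Equiv.Perm.coe_mul, Function.comp_assoc]
    simp only [neg_mul, one_mul, Units.val_neg, Int.cast_neg, neg_smul, smul_add]
    abel

lemma auxI4_of_not_inj_left (r : Fin 4 → Fin m) (c : Fin 4 → Fin n)
    (h : ¬ Function.Injective r) : auxMono r c ∈ auxI4 m n := by
  simp only [Function.Injective, not_forall] at h
  obtain ⟨a, b, hr, hab⟩ := h
  have h1 := auxI4_swap r c a b hab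
  have h2 : auxMono r (c ∘ Equiv.swap a b) = auxMono r c := by
    have hr' : r ∘ Equiv.swap a b = r := by
      funext k
      rcases eq_or_ne k a with rfl | hka
      · simp [hr]
      rcases eq_or_ne k b with rfl | hkb
      · simp [hr]
      simp [Equiv.swap_apply_of_ne_of_ne hka hkb]
    conv_lhs => rw [← hr']
    exact auxMono_perm r c _
  rw [h2, ← two_smul ℂ] at h1
  exact (Submodule.smul_mem_iff _ two_ne_zero).mp h1

lemma auxI4_of_not_inj_right (r : Fin 4 → Fin m) (c : Fin 4 → Fin n)
    (h : ¬ Function.Injective c) : auxMono r c ∈ auxI4 m n := by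
  simp only [Function.Injective, not_forall] at h
  obtain ⟨a, b, hc, hab⟩ := h
  have h1 := auxI4_swap r c a b hab
  have h2 : c ∘ Equiv.swap a b = c := by
    funext k
    rcases eq_or_ne k a with rfl | hka
    · simp [hc]
    rcases eq_or_ne k b with rfl | hkb
    · simp [hc]
    simp [Equiv.swap_apply_of_ne_of_ne hka hkb]
  rw [h2, ← two_smul ℂ] at h1
  exact (Submodule.smul_mem_iff _ two_ne_zero).mp h1

lemma aux_sort {k : ℕ} (r : Fin 4 → Fin k) (h : Function.Injective r) :
    ∃ (R : Fin 4 ↪o Fin k) (e : Equiv.Perm (Fin 4)), r = R ∘ e := by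
  have hm : StrictMono (r ∘ Tuple.sort r) :=
    (Tuple.monotone_sort r).strictMono_of_injective (h.comp (Equiv.injective _))
  refine ⟨OrderEmbedding.ofStrictMono _ hm, (Tuple.sort r)⁻¹, ?_⟩
  funext i
  simp

/-- The standard monomials. -/
noncomputable def auxStd (x : (Fin 4 ↪o Fin m) × (Fin 4 ↪o Fin n)) :
    MvPolynomial (Fin m × Fin n) ℂ := auxMono x.1 x.2

lemma auxMono_mem (r : Fin 4 → Fin m) (c : Fin 4 → Fin n) :
    auxMono r c ∈ auxI4 m n ⊔ Submodule.span ℂ (Set.range (auxStd (m := m) (n := n))) := by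
  by_cases hr : Function.Injective r
  swap
  · exact Submodule.mem_sup_left (auxI4_of_not_inj_left r c hr)
  by_cases hc : Function.Injective c
  swap
  · exact Submodule.mem_sup_left (auxI4_of_not_inj_right r c hc)
  obtain ⟨R, e, rfl⟩ := aux_sort r hr
  obtain ⟨C, f, rfl⟩ := aux_sort c hc
  have h1 : auxMono (R ∘ e) (C ∘ f) = auxMono R (C ∘ (f * e⁻¹ : Equiv.Perm (Fin 4))) := by
    rw [← auxMono_perm R _ e]
    congr 1
    funext k
    simp
  rw [h1]
  have h2 := auxI4_sign R (f * e⁻¹) C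
  have h3 : ((Equiv.Perm.sign (f * e⁻¹) : ℤ) : ℂ) • auxMono R C ∈
      Submodule.span ℂ (Set.range (auxStd (m := m) (n := n))) :=
    Submodule.smul_mem _ _ (Submodule.subset_span ⟨(R, C), rfl⟩)
  have := Submodule.add_mem_sup h2 h3
  simpa using this

lemma auxI4_le : auxI4 m n ≤ homogeneousSubmodule (Fin m × Fin n) ℂ 4 := by
  rintro _ ⟨c, hc, rfl⟩
  refine Submodule.sum_mem _ fun w _ => ?_
  have h1 : (c w).IsHomogeneous 2 := hc w trivial
  have h2 : (perm w).IsHomogeneous 2 := by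
    unfold perm
    exact ((isHomogeneous_X ℂ _).mul (isHomogeneous_X ℂ _)).add
      ((isHomogeneous_X ℂ _).mul (isHomogeneous_X ℂ _))
  exact h1.mul h2

lemma auxMono_mem_homog (r : Fin 4 → Fin m) (c : Fin 4 → Fin n) :
    auxMono r c ∈ homogeneousSubmodule (Fin m × Fin n) ℂ 4 := by
  rw [aux_homog_span]
  exact Submodule.subset_span ⟨fun k => (r k, c k), rfl⟩

lemma auxI4_sup : auxI4 m n ⊔ Submodule.span ℂ (Set.range (auxStd (m := m) (n := n))) =
    homogeneousSubmodule (Fin m × Fin n) ℂ 4 := by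
  apply le_antisymm
  · refine sup_le auxI4_le ?_
    rw [Submodule.span_le]
    rintro _ ⟨x, rfl⟩
    exact auxMono_mem_homog _ _
  · rw [aux_homog_span, Submodule.span_le]
    rintro _ ⟨t, rfl⟩
    exact auxMono_mem (fun k => (t k).1) (fun k => (t k).2)

/-- The alternating value of a tuple. -/
noncomputable def auxD (x : (Fin 4 ↪o Fin m) × (Fin 4 ↪o Fin n)) (r : Fin 4 → Fin m)
    (c : Fin 4 → Fin n) : ℂ :=
  (Matrix.of fun a k => if x.1 a = r k then (1 : ℂ) else 0).det *
    (Matrix.of fun a k => if x.2 a = c k then (1 : ℂ) else 0).det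

lemma auxD_row (x : (Fin 4 ↪o Fin m) × (Fin 4 ↪o Fin n)) (r : Fin 4 → Fin m)
    (c : Fin 4 → Fin n) (e : Equiv.Perm (Fin 4)) :
    auxD x (r ∘ e) c = ((Equiv.Perm.sign e : ℤ) : ℂ) * auxD x r c := by
  have := Matrix.det_permute' e (Matrix.of fun a k => if x.1 a = r k then (1 : ℂ) else 0)
  unfold auxD
  rw [← mul_assoc, ← this]
  rfl

lemma auxD_col (x : (Fin 4 ↪o Fin m) × (Fin 4 ↪o Fin n)) (r : Fin 4 → Fin m)
    (c : Fin 4 → Fin n) (e : Equiv.Perm (Fin 4)) :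
    auxD x r (c ∘ e) = ((Equiv.Perm.sign e : ℤ) : ℂ) * auxD x r c := by
  have := Matrix.det_permute' e (Matrix.of fun a k => if x.2 a = c k then (1 : ℂ) else 0)
  unfold auxD
  rw [mul_left_comm, ← this]
  rfl

lemma auxD_both (x : (Fin 4 ↪o Fin m) × (Fin 4 ↪o Fin n)) (r : Fin 4 → Fin m)
    (c : Fin 4 → Fin n) (e : Equiv.Perm (Fin 4)) :
    auxD x (r ∘ e) (c ∘ e) = auxD x r c := by
  rw [auxD_row, auxD_col, ← mul_assoc]
  rcases Int.units_eq_one_or (Equiv.Perm.sign e) with h | h <;> simp [h]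

open Classical in
/-- The value of the functional on a monomial. -/
noncomputable def auxVal (s : (Fin m × Fin n) →₀ ℕ) :
    (Fin 4 ↪o Fin m) × (Fin 4 ↪o Fin n) → ℂ := fun x =>
  if h : ∃ t : Fin 4 → Fin m × Fin n, s = ∑ k, Finsupp.single (t k) 1 then
    auxD x (fun k => (h.choose k).1) (fun k => (h.choose k).2) else 0

/-- The functional. -/
noncomputable def auxPhi (m n : ℕ) : MvPolynomial (Fin m × Fin n) ℂ →ₗ[ℂ]
    ((Fin 4 ↪o Fin m) × (Fin 4 ↪o Fin n) → ℂ) :=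
  (basisMonomials (Fin m × Fin n) ℂ).constr ℂ auxVal

lemma auxPhi_mono (r : Fin 4 → Fin m) (c : Fin 4 → Fin n) :
    auxPhi m n (auxMono r c) = fun x => auxD x r c := by
  unfold auxMono
  rw [aux_prod_X 4 (fun k => (r k, c k))]
  have hb := congrFun (coe_basisMonomials (Fin m × Fin n) ℂ) (∑ k, Finsupp.single (r k, c k) 1)
  unfold auxPhi
  rw [← hb, Module.Basis.constr_basis]
  funext x
  have h : ∃ t : Fin 4 → Fin m × Fin n, ∑ k, Finsupp.single (r k, c k) 1 =
      ∑ k, (Finsupp.single (t k) 1 : (Fin m × Fin n) →₀ ℕ) := ⟨_, rfl⟩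
  unfold auxVal
  rw [dif_pos h]
  obtain ⟨e, he⟩ := aux_exists_perm _ _ h.choose_spec
  rw [← auxD_both x _ _ e]
  congr 1
  · funext k; simp [he]
  · funext k; simp [he]

lemma auxI4_le_ker : auxI4 m n ≤ LinearMap.ker (auxPhi m n) := by
  rintro _ ⟨c, hc, rfl⟩
  refine Submodule.sum_mem _ fun w _ => ?_
  have h1 : c w ∈ homogeneousSubmodule (Fin m × Fin n) ℂ 2 := hc w trivial
  rw [aux_homog_span] at h1
  generalize c w = g at h1 ⊢
  induction h1 using Submodule.span_induction with
  | zero => simp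
  | add a b _ _ ha hb => rw [add_mul]; exact Submodule.add_mem _ ha hb
  | smul r a _ ha => rw [smul_mul_assoc]; exact Submodule.smul_mem _ _ ha
  | mem f hf =>
    obtain ⟨t, rfl⟩ := hf
    have h2 : (∏ k, X (t k)) * perm w =
        auxMono ![w.1.1.1, w.1.1.2, (t 0).1, (t 1).1] ![w.1.2.1, w.1.2.2, (t 0).2, (t 1).2] +
        auxMono ![w.1.1.1, w.1.1.2, (t 0).1, (t 1).1]
          (![w.1.2.1, w.1.2.2, (t 0).2, (t 1).2] ∘ Equiv.swap 0 1) := by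
      have e2 : (Equiv.swap 0 1 : Equiv.Perm (Fin 4)) 2 = 2 := by decide
      have e3 : (Equiv.swap 0 1 : Equiv.Perm (Fin 4)) 3 = 3 := by decide
      simp only [auxMono, perm, Fin.prod_univ_four, Fin.prod_univ_two, Function.comp,
        Equiv.swap_apply_left, Equiv.swap_apply_right, e2, e3]
      simp
      ring
    rw [LinearMap.mem_ker, h2, map_add, auxPhi_mono, auxPhi_mono]
    funext x
    rw [Pi.add_apply, auxD_col, Equiv.Perm.sign_swap (by decide)]
    simp

lemma aux_det_orderEmb {k : ℕ} (A B : Fin 4 ↪o Fin k) :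
    (Matrix.of fun a b => if A a = B b then (1 : ℂ) else 0).det = if A = B then 1 else 0 := by
  split_ifs with h
  · subst h
    convert Matrix.det_one (n := Fin 4) (R := ℂ) using 2
    ext a b
    simp [Matrix.one_apply]
  · obtain ⟨a, ha⟩ : ∃ a, ∀ b, A a ≠ B b := by
      by_contra hcon
      push Not at hcon
      apply h
      have hr : Set.range A = Set.range B := by
        apply Set.eq_of_subset_of_card_le
        · rintro _ ⟨a, rfl⟩
          obtain ⟨b, hb⟩ := hcon a
          exact ⟨b, hb.symm⟩
        · rw [Set.card_range_of_injective A.injective, Set.card_range_of_injective B.injective]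
      exact DFunLike.coe_injective ((StrictMono.range_inj A.strictMono B.strictMono).mp hr)
    exact Matrix.det_eq_zero_of_row_eq_zero a (fun b => by simp [ha b])

lemma auxPhi_std (y : (Fin 4 ↪o Fin m) × (Fin 4 ↪o Fin n)) :
    auxPhi m n (auxStd y) = Pi.single y 1 := by
  unfold auxStd
  rw [auxPhi_mono]
  funext x
  unfold auxD
  rw [aux_det_orderEmb, aux_det_orderEmb]
  by_cases h : x = y
  · subst h; simp
  · rw [Pi.single_eq_of_ne h]
    have : ¬ (x.1 = y.1 ∧ x.2 = y.2) := fun hh => h (Prod.ext hh.1 hh.2)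
    by_cases h1 : x.1 = y.1
    · simp [h1] at this; simp [this]
    · simp [h1]

lemma aux_card_orderEmb (k : ℕ) : Fintype.card (Fin 4 ↪o Fin k) = k.choose 4 := by
  rw [← Nat.card_eq_fintype_card, Nat.card_congr (Set.powersetCard.ofFinEmbEquiv (n := 4)
    (I := Fin k)), Set.powersetCard.card]
  simp

lemma auxI4_finrank : Module.finrank ℂ (auxI4 m n) + m.choose 4 * n.choose 4 =
    Nat.multichoose (m * n) 4 := by
  have hstd : LinearIndependent ℂ (auxStd (m := m) (n := n)) := by
    apply LinearIndependent.of_comp (auxPhi m n)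
    have : (auxPhi m n ∘ auxStd) = fun y => Pi.single y (1 : ℂ) := funext auxPhi_std
    rw [this]
    exact Pi.linearIndependent_single_one _ ℂ
  have hfin : FiniteDimensional ℂ (homogeneousSubmodule (Fin m × Fin n) ℂ 4) :=
    Module.Finite.iff_fg.mpr (homogeneousSubmodule_fg _ _ _)
  have : FiniteDimensional ℂ (auxI4 m n) := Submodule.finiteDimensional_of_le auxI4_le
  have hinf : auxI4 m n ⊓ Submodule.span ℂ (Set.range (auxStd (m := m) (n := n))) = ⊥ := by
    rw [eq_bot_iff]
    rintro f ⟨h1, h2⟩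
    have h3 := auxI4_le_ker h1
    obtain ⟨a, rfl⟩ := (Submodule.mem_span_range_iff_exists_fun ℂ).mp h2
    rw [LinearMap.mem_ker, map_sum] at h3
    simp only [map_smul, auxPhi_std] at h3
    have h4 : a = 0 := by
      funext x
      have := congrFun h3 x
      simpa [Finset.sum_apply, Pi.single_apply] using this
    simp [h4]
  have : FiniteDimensional ℂ (Submodule.span ℂ (Set.range (auxStd (m := m) (n := n)))) :=
    FiniteDimensional.span_of_finite ℂ (Set.finite_range _)
  have h := Submodule.finrank_sup_add_finrank_inf_eq (auxI4 m n)
    (Submodule.span ℂ (Set.range (auxStd (m := m) (n := n))))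
  rw [hinf, finrank_bot, add_zero, auxI4_sup, aux_finrank_homog, finrank_span_eq_card hstd,
    Fintype.card_prod, Fintype.card_prod, aux_card_orderEmb, aux_card_orderEmb,
    Fintype.card_fin, Fintype.card_fin] at h
  exact h.symm

end Ideal

/-! ### Koszul syzygies -/

section Koszul
variable {m n : ℕ}

/-- The leading exponent of a permanent. -/
noncomputable def auxExp (w : PermIdx m n) : (Fin m × Fin n) →₀ ℕ :=
  Finsupp.single (w.1.1.1, w.1.2.1) 1 + Finsupp.single (w.1.1.2, w.1.2.2) 1

lemma aux_perm_eq (w : PermIdx m n) : perm w = monomial (auxExp w) 1 +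
    monomial (Finsupp.single (w.1.1.1, w.1.2.2) 1 + Finsupp.single (w.1.1.2, w.1.2.1) 1) 1 := by
  simp [perm, auxExp, X, monomial_mul]

lemma aux_coeff_self (w : PermIdx m n) : coeff (auxExp w) (perm w) ≠ 0 := by
  rw [aux_perm_eq, coeff_add, coeff_monomial, coeff_monomial, if_pos rfl]
  split_ifs <;> norm_num

lemma aux_coeff_ne (w v : PermIdx m n) (h : v ≠ w) : coeff (auxExp w) (perm v) = 0 := by
  have hi := w.2.1
  have hj := w.2.2
  have hk := v.2.1
  have hl := v.2.2
  have key : ¬ (v.1.1.1 = w.1.1.1 ∧ v.1.1.2 = w.1.1.2 ∧ v.1.2.1 = w.1.2.1 ∧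
      v.1.2.2 = w.1.2.2) := by
    rintro ⟨h1, h2, h3, h4⟩
    exact h (Subtype.ext (Prod.ext (Prod.ext h1 h2) (Prod.ext h3 h4)))
  rw [aux_perm_eq, coeff_add, coeff_monomial, coeff_monomial, if_neg, if_neg, add_zero]
  · unfold auxExp
    rw [Finsupp.single_add_single_eq_single_add_single one_ne_zero one_ne_zero]
    simp only [Prod.mk.injEq]
    grind
  · unfold auxExp
    rw [Finsupp.single_add_single_eq_single_add_single one_ne_zero one_ne_zero]
    simp only [Prod.mk.injEq]
    grind

lemma aux_perm_homog (w : PermIdx m n) : (perm w).IsHomogeneous 2 := by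
  unfold perm
  exact ((isHomogeneous_X ℂ _).mul (isHomogeneous_X ℂ _)).add
    ((isHomogeneous_X ℂ _).mul (isHomogeneous_X ℂ _))

/-- Koszul syzygies. -/
noncomputable def auxKg (w w' : PermIdx m n) : PermIdx m n → MvPolynomial (Fin m × Fin n) ℂ :=
  Pi.single w (perm w') - Pi.single w' (perm w)

lemma auxKg_homog (w w' v : PermIdx m n) : (auxKg w w' v).IsHomogeneous 2 := by
  unfold auxKg
  rw [Pi.sub_apply]
  refine IsHomogeneous.sub ?_ ?_
  · rw [Pi.single_apply]; split_ifs
    · exact aux_perm_homog _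
    · exact isHomogeneous_zero _ _ _
  · rw [Pi.single_apply]; split_ifs
    · exact aux_perm_homog _
    · exact isHomogeneous_zero _ _ _

lemma auxKg_mem_syz (w w' : PermIdx m n) : auxKg w w' ∈ SyzBar m n 4 := by
  refine ⟨auxKg_homog w w', ?_⟩
  unfold auxKg
  simp only [Pi.sub_apply, sub_mul, Finset.sum_sub_distrib, Pi.single_apply, ite_mul, zero_mul,
    Finset.sum_ite_eq', Finset.sum_ite_eq, Finset.mem_univ, if_true]
  ring

/-- Ordered Koszul syzygies. -/
noncomputable def auxKo (m n : ℕ)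
    (x : {x : Fin (Fintype.card (PermIdx m n)) × Fin (Fintype.card (PermIdx m n)) // x.1 < x.2}) :
    PermIdx m n → MvPolynomial (Fin m × Fin n) ℂ :=
  auxKg ((Fintype.equivFin _).symm x.1.1) ((Fintype.equivFin _).symm x.1.2)

lemma auxKg_mem_span (w w' : PermIdx m n) :
    auxKg w w' ∈ Submodule.span ℂ (Set.range (auxKo m n)) := by
  rcases lt_trichotomy (Fintype.equivFin _ w) (Fintype.equivFin _ w') with h | h | h
  · exact Submodule.subset_span ⟨⟨(_, _), h⟩, by simp [auxKo]⟩
  · have : w = w' := (Fintype.equivFin _).injective h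
    subst this
    simp [auxKg]
  · have h1 : auxKg w w' = - auxKg w' w := by simp [auxKg]
    rw [h1]
    exact Submodule.neg_mem _ (Submodule.subset_span ⟨⟨(_, _), h⟩, by simp [auxKo]⟩)

/-- Degree two component of a family. -/
noncomputable def auxComp (m n : ℕ) :
    (PermIdx m n → MvPolynomial (Fin m × Fin n) ℂ) →ₗ[ℂ]
      (PermIdx m n → MvPolynomial (Fin m × Fin n) ℂ) :=
  LinearMap.pi fun w => (homogeneousComponent 2) ∘ₗ LinearMap.proj w

lemma aux_hcomp (s g : MvPolynomial (Fin m × Fin n) ℂ) (hg : g.IsHomogeneous 2) :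
    homogeneousComponent 2 (s * g) = coeff 0 s • g := by
  conv_lhs => rw [← sum_homogeneousComponent s]
  rw [Finset.sum_mul, map_sum, Finset.sum_eq_single 0]
  · rw [homogeneousComponent_zero, ← smul_eq_C_mul, map_smul, homogeneousComponent_of_mem hg,
      if_pos rfl]
  · intro i _ hi
    have : (homogeneousComponent i s * g).IsHomogeneous (i + 2) :=
      (homogeneousComponent_isHomogeneous i s).mul hg
    rw [homogeneousComponent_of_mem this, if_neg (by omega)]
  · intro h
    simp at h

lemma auxComp_mem (k : PermIdx m n → MvPolynomial (Fin m × Fin n) ℂ) (hk : k ∈ KosModBar m n) :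
    auxComp m n k ∈ Submodule.span ℂ (Set.range (auxKo m n)) := by
  unfold KosModBar at hk
  rw [Submodule.mem_span_iff_exists_finset_subset] at hk
  obtain ⟨a, t, ht, _, rfl⟩ := hk
  rw [map_sum]
  refine Submodule.sum_mem _ fun g hg => ?_
  obtain ⟨w, w', h⟩ := ht hg
  have hg' : g = auxKg w w' := h
  have : auxComp m n (a g • g) = coeff 0 (a g) • g := by
    funext v
    change homogeneousComponent 2 (a g * g v) = coeff 0 (a g) • g v
    apply aux_hcomp
    rw [hg']
    exact auxKg_homog _ _ _
  rw [this, hg']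
  exact Submodule.smul_mem _ _ (auxKg_mem_span w w')

lemma auxKos_eq : KosBar m n 4 = Submodule.span ℂ (Set.range (auxKo m n)) := by
  apply le_antisymm
  · rintro k ⟨h1, h2⟩
    have h3 := auxComp_mem k h2
    have h4 : auxComp m n k = k := by
      funext v
      change homogeneousComponent 2 (k v) = k v
      have : k v ∈ homogeneousSubmodule (Fin m × Fin n) ℂ 2 := h1.1 v
      rw [homogeneousComponent_of_mem this, if_pos rfl]
    rwa [h4] at h3
  · rw [Submodule.span_le]
    rintro _ ⟨x, rfl⟩
    exact ⟨auxKg_mem_syz _ _, Submodule.subset_span ⟨_, _, rfl⟩⟩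

lemma auxKo_indep : LinearIndependent ℂ (auxKo m n) := by
  rw [Fintype.linearIndependent_iff]
  intro a ha x0
  have h1 := congrArg (coeff (auxExp ((Fintype.equivFin _).symm x0.1.2)))
    (congrFun ha ((Fintype.equivFin _).symm x0.1.1))
  rw [Finset.sum_apply, coeff_sum, Finset.sum_eq_single x0] at h1
  · have hne : (Fintype.equivFin (PermIdx m n)).symm x0.1.1 ≠
        (Fintype.equivFin (PermIdx m n)).symm x0.1.2 :=
      fun h => x0.2.ne ((Fintype.equivFin _).symm.injective h)
    simp only [Pi.smul_apply, auxKo, auxKg, Pi.sub_apply, Pi.single_eq_same,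
      Pi.single_eq_of_ne hne, sub_zero, coeff_smul, smul_eq_mul, Pi.zero_apply, coeff_zero] at h1
    exact (mul_eq_zero.mp h1).resolve_right (aux_coeff_self _)
  · intro x _ hx
    simp only [Pi.smul_apply, auxKo, auxKg, Pi.sub_apply, coeff_smul, coeff_sub, smul_eq_mul]
    apply mul_eq_zero_of_right
    rw [Pi.single_apply, Pi.single_apply]
    have e1 : coeff (auxExp ((Fintype.equivFin (PermIdx m n)).symm x0.1.2))
      (if (Fintype.equivFin _).symm x0.1.1 = (Fintype.equivFin _).symm x.1.1 then
        perm ((Fintype.equivFin _).symm x.1.2) else 0) = 0 := by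
      split_ifs with h
      · apply aux_coeff_ne
        intro h'
        exact hx (Subtype.ext (Prod.ext ((Equiv.injective _ h).symm) (Equiv.injective _ h')))
      · simp
    have e2 : coeff (auxExp ((Fintype.equivFin (PermIdx m n)).symm x0.1.2))
      (if (Fintype.equivFin _).symm x0.1.1 = (Fintype.equivFin _).symm x.1.2 then
        perm ((Fintype.equivFin _).symm x.1.1) else 0) = 0 := by
      split_ifs with h
      · apply aux_coeff_ne
        intro h'
        have h2 := Equiv.injective _ h
        have h3 := Equiv.injective _ h'
        have h4 := x.2
        have h5 := x0.2
        rw [h2, ← h3] at h5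
        exact absurd h4 (lt_asymm h5)
      · simp
    rw [e1, e2, sub_zero]
  · simp

lemma auxKos_finrank :
    Module.finrank ℂ (KosBar m n 4) = (Fintype.card (PermIdx m n)).choose 2 := by
  rw [auxKos_eq, finrank_span_eq_card auxKo_indep, Fintype.card_subtype,
    ← Finset.univ_product_univ, Finset.card_product_filter_lt]
  simp

lemma auxQuad_finrank : FiniteDimensional ℂ (auxQuad m n) ∧ Module.finrank ℂ (auxQuad m n) =
    Fintype.card (PermIdx m n) * Nat.multichoose (m * n) 2 := by
  have hfin : FiniteDimensional ℂ (homogeneousSubmodule (Fin m × Fin n) ℂ 2) :=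
    Module.Finite.iff_fg.mpr (homogeneousSubmodule_fg _ _ _)
  let L : (PermIdx m n → homogeneousSubmodule (Fin m × Fin n) ℂ 2) →ₗ[ℂ]
      (PermIdx m n → MvPolynomial (Fin m × Fin n) ℂ) :=
    LinearMap.pi fun w => (Submodule.subtype _) ∘ₗ LinearMap.proj w
  have hL : Function.Injective L := by
    intro a b h
    funext w
    exact Subtype.ext (congrFun h w)
  have hr : LinearMap.range L = auxQuad m n := by
    ext c
    constructor
    · rintro ⟨a, rfl⟩ w _
      exact (a w).2
    · intro h
      exact ⟨fun w => ⟨c w, h w trivial⟩, rfl⟩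
  rw [← hr]
  refine ⟨inferInstance, ?_⟩
  rw [LinearMap.finrank_range_of_inj hL, Module.finrank_pi_fintype]
  simp [aux_finrank_homog]

lemma auxSyz_le : SyzBar m n 4 ≤ auxQuad m n := fun _ h w _ => h.1 w

lemma auxSyz_finrank : Module.finrank ℂ (auxI4 m n) + Module.finrank ℂ (SyzBar m n 4) =
    Fintype.card (PermIdx m n) * Nat.multichoose (m * n) 2 := by
  obtain ⟨hf, hq⟩ := auxQuad_finrank (m := m) (n := n)
  have h := LinearMap.finrank_range_add_finrank_ker ((auxMap m n).domRestrict (auxQuad m n))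
  have hk : LinearMap.ker ((auxMap m n).domRestrict (auxQuad m n)) =
      Submodule.comap (auxQuad m n).subtype (SyzBar m n 4) := by
    ext c
    constructor
    · intro hc
      exact ⟨fun w => c.2 w trivial, hc⟩
    · intro hc
      exact hc.2
  rw [LinearMap.range_domRestrict, hk,
    (Submodule.comapSubtypeEquivOfLe auxSyz_le).finrank_eq, hq] at h
  exact h

lemma aux_quot_finrank : Module.finrank ℂ
      (↥(SyzBar m n 4) ⧸ Submodule.comap (SyzBar m n 4).subtype (KosBar m n 4)) +
      (Fintype.card (PermIdx m n)).choose 2 = Module.finrank ℂ (SyzBar m n 4) := by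
  have := (auxQuad_finrank (m := m) (n := n)).1
  have : FiniteDimensional ℂ (SyzBar m n 4) := Submodule.finiteDimensional_of_le auxSyz_le
  have h := Submodule.finrank_quotient_add_finrank
    (Submodule.comap (SyzBar m n 4).subtype (KosBar m n 4))
  have hle : KosBar m n 4 ≤ SyzBar m n 4 := inf_le_left
  rwa [(Submodule.comapSubtypeEquivOfLe hle).finrank_eq,
    auxKos_finrank] at h

lemma aux_card_idx : Fintype.card (PermIdx m n) = (m + 1).choose 2 * (n + 1).choose 2 := by
  have e : PermIdx m n ≃ {x : Fin m × Fin m // x.1 ≤ x.2} × {y : Fin n × Fin n // y.1 ≤ y.2} :=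
    { toFun := fun w => (⟨w.1.1, w.2.1⟩, ⟨w.1.2, w.2.2⟩)
      invFun := fun z => ⟨(z.1.1, z.2.1), z.1.2, z.2.2⟩
      left_inv := fun _ => rfl
      right_inv := fun _ => rfl }
  rw [Fintype.card_congr e, Fintype.card_prod, ← Fintype.card_congr Sym2.sortEquiv,
    ← Fintype.card_congr Sym2.sortEquiv, Sym2.card, Sym2.card, Fintype.card_fin, Fintype.card_fin]

end Koszul

/-! ### Arithmetic -/

section Arith

lemma aux_ch2 (k : ℕ) : (k.choose 2 : ℚ) = k * (k - 1) / 2 := by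
  induction k with
  | zero => simp
  | succ k ih => rw [Nat.choose_succ_succ' k 1]; push_cast; rw [ih, Nat.choose_one_right]; ring

lemma aux_ch3 (k : ℕ) : (k.choose 3 : ℚ) = k * (k - 1) * (k - 2) / 6 := by
  induction k with
  | zero => simp
  | succ k ih => rw [Nat.choose_succ_succ' k 2]; push_cast; rw [ih, aux_ch2]; ring

lemma aux_ch4 (k : ℕ) : (k.choose 4 : ℚ) = k * (k - 1) * (k - 2) * (k - 3) / 24 := by
  induction k with
  | zero => simp
  | succ k ih => rw [Nat.choose_succ_succ' k 3]; push_cast; rw [ih, aux_ch3]; ring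

lemma aux_div1 (k : ℕ) (hk : 1 ≤ k) :
    k ^ 2 * (k ^ 2 - 1) / 12 = (k + 2).choose 4 + (k + 1).choose 4 := by
  apply Nat.div_eq_of_eq_mul_right (by norm_num)
  have h1 : 1 ≤ k ^ 2 := Nat.one_le_pow _ _ hk
  have : ((k ^ 2 * (k ^ 2 - 1) : ℕ) : ℚ) =
      ((12 * ((k + 2).choose 4 + (k + 1).choose 4) : ℕ) : ℚ) := by
    push_cast [Nat.cast_sub h1]
    rw [aux_ch4, aux_ch4]
    push_cast
    ring
  exact_mod_cast this

lemma aux_div2 (k : ℕ) (hk : 1 ≤ k) :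
    k * (k + 1) * (k + 2) * (k - 1) / 8 = 3 * (k + 2).choose 4 := by
  apply Nat.div_eq_of_eq_mul_right (by norm_num)
  have : ((k * (k + 1) * (k + 2) * (k - 1) : ℕ) : ℚ) =
      ((8 * (3 * (k + 2).choose 4) : ℕ) : ℚ) := by
    push_cast [Nat.cast_sub hk]
    rw [aux_ch4]
    push_cast
    ring
  exact_mod_cast this

lemma aux_div3 (k : ℕ) (hk : 1 ≤ k) :
    k * (k + 1) * (k - 1) * (k - 2) / 8 = 3 * (k + 1).choose 4 := by
  apply Nat.div_eq_of_eq_mul_right (by norm_num)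
  rcases Nat.lt_or_ge k 2 with h | h
  · have : k = 1 := by omega
    subst this
    decide
  have : ((k * (k + 1) * (k - 1) * (k - 2) : ℕ) : ℚ) =
      ((8 * (3 * (k + 1).choose 4) : ℕ) : ℚ) := by
    push_cast [Nat.cast_sub hk, Nat.cast_sub h]
    rw [aux_ch4]
    push_cast
    ring
  exact_mod_cast this

end Arith

/-- The degree-4 part of the first Koszul homology of the generalized 2×2
permanents, `Syz̄₄ / Kos̄₄`, has the stated dimension. -/
theorem dim_koszul_homology_permanents_degree_four (m n : ℕ) (hm : 1 ≤ m) (hn : 1 ≤ n) :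
    Module.finrank ℂ
      (↥(SyzBar m n 4) ⧸ Submodule.comap (SyzBar m n 4).subtype (KosBar m n 4)) =
      m ^ 2 * (m ^ 2 - 1) / 12 * Nat.choose (n + 3) 4 +
        Nat.choose (m + 3) 4 * (n ^ 2 * (n ^ 2 - 1) / 12) +
        m * (m + 1) * (m + 2) * (m - 1) / 8 * (n * (n + 1) * (n + 2) * (n - 1) / 8) +
        m * (m + 1) * (m + 2) * (m - 1) / 8 * (n * (n + 1) * (n - 1) * (n - 2) / 8) +
        m * (m + 1) * (m - 1) * (m - 2) / 8 * (n * (n + 1) * (n + 2) * (n - 1) / 8) := by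
  rw [aux_div1 m hm, aux_div1 n hn, aux_div2 m hm, aux_div2 n hn, aux_div3 m hm, aux_div3 n hn]
  have h1 := auxI4_finrank (m := m) (n := n)
  have h2 := auxSyz_finrank (m := m) (n := n)
  have h3 := aux_quot_finrank (m := m) (n := n)
  rw [aux_card_idx] at h2 h3
  generalize Module.finrank ℂ
    (↥(SyzBar m n 4) ⧸ Submodule.comap (SyzBar m n 4).subtype (KosBar m n 4)) = q at h3 ⊢
  rw [Nat.multichoose_eq] at h1 h2
  have e4 : m * n + 4 - 1 = m * n + 3 := by omega
  have e2 : m * n + 2 - 1 = m * n + 1 := by omega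
  rw [e4] at h1
  rw [e2] at h2
  have h1' := congrArg (Nat.cast : ℕ → ℚ) h1
  have h2' := congrArg (Nat.cast : ℕ → ℚ) h2
  have h3' := congrArg (Nat.cast : ℕ → ℚ) h3
  have goal : (q : ℚ) = (((m + 2).choose 4 + (m + 1).choose 4) * Nat.choose (n + 3) 4 +
      Nat.choose (m + 3) 4 * ((n + 2).choose 4 + (n + 1).choose 4) +
      3 * (m + 2).choose 4 * (3 * (n + 2).choose 4) +
      3 * (m + 2).choose 4 * (3 * (n + 1).choose 4) +
      3 * (m + 1).choose 4 * (3 * (n + 2).choose 4) : ℕ) := by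
    push_cast [aux_ch2, aux_ch4] at h1' h2' h3' ⊢
    linear_combination h3' + h2' - h1'
  exact_mod_cast goal
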